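/- Let (X,d,α) be a semi-computable metric space and let L be recursively enumerable. If f is (U,V)-computable, then there exists a recursively enumerable topological (α,β)-approximation system for f. -/

import Mathlib

/-- A set in a primcodable type is recursively enumerable. -/
def IsRE {α : Type} [Primcodable α] (S : Set α) : Prop :=
  Partrec fun a => Part.assert (a ∈ S) fun _ => Part.some ()

/-- `F` is an enumeration operator. -/
def IsEnumOp (F : Set ℕ → Set ℕ) : Prop :=
  ∃ W : Set (List ℕ × ℕ), IsRE W ∧
    ∀ M : Set ℕ, F M = {j | ∃ l : List ℕ, (∀ i ∈ l, i ∈ M) ∧ (l, j) ∈ W}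

/-- `(Z, dist, γ)` with `dom γ = K` is a semi-computable metric space. -/
def SemiComputable {Z : Type*} [MetricSpace Z] (K : Set ℕ) (γ : ℕ → Z) : Prop :=
  Dense (γ '' K) ∧
  IsRE {q : ℕ × ℕ × ℕ × ℕ | q.1 ∈ K ∧ q.2.1 ∈ K ∧ 0 < q.2.2.1 ∧ 0 < q.2.2.2 ∧
      dist (γ q.1) (γ q.2.1) < (q.2.2.1 : ℝ) / (q.2.2.2 : ℝ)}

theorem re_iff_aux {α : Type} [Primcodable α] {p : α → Prop} :
    REPred p ↔ ∃ R : α → ℕ → Prop, PrimrecRel R ∧ ∀ a, p a ↔ ∃ n, R a n := by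
  constructor
  · intro h
    obtain ⟨c, hc⟩ := Nat.Partrec.Code.exists_code.1 h
    refine ⟨fun a n => (Nat.Partrec.Code.evaln n c (Encodable.encode a)).isSome = true, ?_, ?_⟩
    · refine PrimrecRel.comp Primrec.eq (Primrec.option_isSome.comp ?_) (Primrec.const true)
      exact Nat.Partrec.Code.primrec_evaln.comp
        (Primrec.pair (Primrec.pair Primrec.snd (Primrec.const c)) (Primrec.encode.comp Primrec.fst))
    · intro a
      have h1 : p a ↔ ∃ x, x ∈ Nat.Partrec.Code.eval c (Encodable.encode a) := by
        rw [hc]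
        simp
      rw [h1]
      simp only [Nat.Partrec.Code.evaln_complete, Option.isSome_iff_exists, Option.mem_def]
      exact exists_comm
  · rintro ⟨R, hR, h⟩
    classical
    have : Partrec fun a => Nat.rfind fun n => Part.some (decide (R a n)) :=
      Partrec.rfind (Computable.partrec (hR.decide.to_comp))
    refine this.dom_re.of_eq fun a => ?_
    rw [h]
    refine Nat.rfind_dom.trans ?_
    constructor
    · rintro ⟨n, hn, _⟩
      exact ⟨n, by simpa using hn⟩
    · rintro ⟨n, hn⟩
      exact ⟨n, by simpa using hn, fun _ => trivial⟩

theorem re_comp {α β : Type} [Primcodable α] [Primcodable β] {p : β → Prop} (h : REPred p)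
    {f : α → β} (hf : Computable f) : REPred fun a => p (f a) := Partrec.comp h hf

theorem re_and {α : Type} [Primcodable α] {p q : α → Prop} (hp : REPred p) (hq : REPred q) :
    REPred fun a => p a ∧ q a := by
  obtain ⟨R, hR, h⟩ := re_iff_aux.1 hp
  obtain ⟨T, hT, h'⟩ := re_iff_aux.1 hq
  refine re_iff_aux.2 ⟨fun a n => R a n.unpair.1 ∧ T a n.unpair.2, ?_, ?_⟩
  · exact PrimrecPred.and
      (hR.comp Primrec.fst (Primrec.fst.comp (Primrec.unpair.comp Primrec.snd)))
      (hT.comp Primrec.fst (Primrec.snd.comp (Primrec.unpair.comp Primrec.snd)))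
  · intro a
    rw [h, h']
    constructor
    · rintro ⟨⟨n, hn⟩, ⟨m, hm⟩⟩
      exact ⟨Nat.pair n m, by simpa using ⟨hn, hm⟩⟩
    · rintro ⟨n, h1, h2⟩
      exact ⟨⟨_, h1⟩, ⟨_, h2⟩⟩

theorem re_exists {α β : Type} [Primcodable α] [Primcodable β] [Inhabited β]
    {p : α → β → Prop} (hp : REPred fun q : α × β => p q.1 q.2) :
    REPred fun a => ∃ b, p a b := by
  obtain ⟨R, hR, h⟩ := re_iff_aux.1 hp
  refine re_iff_aux.2 ⟨fun a n =>
    R (a, (Encodable.decode (α := β) n.unpair.1).getD default) n.unpair.2, ?_, ?_⟩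
  · refine hR.comp (Primrec.pair Primrec.fst (Primrec.option_getD.comp
      (Primrec.decode.comp (Primrec.fst.comp (Primrec.unpair.comp Primrec.snd)))
      (Primrec.const _)))
      (Primrec.snd.comp (Primrec.unpair.comp Primrec.snd))
  · intro a
    constructor
    · rintro ⟨b, hb⟩
      obtain ⟨n, hn⟩ := (h (a, b)).1 hb
      exact ⟨Nat.pair (Encodable.encode b) n, by simpa using hn⟩
    · rintro ⟨n, hn⟩
      exact ⟨_, (h (a, _)).2 ⟨_, hn⟩⟩

theorem re_forall_list {α : Type} [Primcodable α] {p : α → Prop} (hp : REPred p) :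
    REPred fun w : List α => ∀ a ∈ w, p a := by
  obtain ⟨R, hR, h⟩ := re_iff_aux.1 hp
  refine re_iff_aux.2 ⟨fun w n => ∀ a ∈ w, ∃ m ∈ List.range n, R a m, ?_, ?_⟩
  · have h1 : PrimrecRel fun (m : ℕ) (a : α) => R a m := hR.comp Primrec.snd Primrec.fst
    have h2 := PrimrecRel.exists_mem_list h1
    have h3 : PrimrecRel fun (a : α) (n : ℕ) => ∃ m ∈ List.range n, R a m :=
      h2.comp (Primrec.list_range.comp Primrec.snd) Primrec.fst
    exact h3.forall_mem_list
  · intro w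
    simp only [h, List.mem_range]
    constructor
    · intro hw
      induction w with
      | nil => exact ⟨0, by simp⟩
      | cons b w ih =>
        obtain ⟨n, hn⟩ := ih fun a ha => hw a (List.mem_cons_of_mem _ ha)
        obtain ⟨m, hm⟩ := hw b (by simp)
        refine ⟨n + m + 1, ?_⟩
        intro a ha
        rcases List.mem_cons.1 ha with rfl | ha
        · exact ⟨m, by omega, hm⟩
        · obtain ⟨k, hk, hk'⟩ := hn a ha
          exact ⟨k, by omega, hk'⟩
    · rintro ⟨n, hn⟩ a ha
      obtain ⟨m, _, hm⟩ := hn a ha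
      exact ⟨m, hm⟩

def oldEnc (x : ℚ) : ℕ := @Encodable.encode ℚ Rat.instEncodable x

theorem oldEnc_eq (x : ℚ) : oldEnc x = Nat.pair (Encodable.encode x.num) x.den := rfl

open Classical in
theorem newEnc_eq (x : ℚ) : @Encodable.encode ℚ (Primcodable.ofDenumerable ℚ).toEncodable x =
    (List.range (oldEnc x)).countP (fun e => e ∈ Set.range oldEnc) := by
  trans (@List.countP ℕ (fun e => @decide (e ∈ Set.range oldEnc)
    (@Encodable.decidableRangeEncode ℚ Rat.instEncodable e)) (List.range (oldEnc x)))
  · rfl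
  · congr 1
    funext e
    exact decide_eq_decide.2 Iff.rfl

theorem natCast_enc (a : ℕ) : Encodable.encode (a : ℤ) = 2 * a := rfl
theorem negSucc_enc (a : ℕ) : Encodable.encode (Int.negSucc a) = 2 * a + 1 := rfl

theorem mem_range_oldEnc (e : ℕ) : e ∈ Set.range oldEnc ↔
    0 < e.unpair.2 ∧ ∀ c < e.unpair.2 + 1,
      ¬ (((e.unpair.1 + 1) / 2) % c = 0 ∧ e.unpair.2 % c = 0 ∧ c ≠ 1) := by
  have key : ∀ a d : ℕ, 0 < d → ((∀ c < d + 1, ¬ (a % c = 0 ∧ d % c = 0 ∧ c ≠ 1)) ↔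
      a.Coprime d) := by
    intro a d hd
    constructor
    · intro h
      by_contra hc
      exact h (a.gcd d) (Nat.lt_succ_of_le (Nat.gcd_le_right _ hd))
        ⟨Nat.mod_eq_zero_of_dvd (Nat.gcd_dvd_left _ _),
          Nat.mod_eq_zero_of_dvd (Nat.gcd_dvd_right _ _), hc⟩
    · rintro h c _ ⟨h1, h2, h3⟩
      exact h3 (Nat.eq_one_of_dvd_coprimes h (Nat.dvd_of_mod_eq_zero h1) (Nat.dvd_of_mod_eq_zero h2))
  have habs : ∀ z : ℤ, (Encodable.encode z + 1) / 2 = z.natAbs := by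
    intro z
    cases z with
    | ofNat a => have := natCast_enc a; simp only [Int.ofNat_eq_natCast, this]; omega
    | negSucc a => rw [negSucc_enc]; simp; omega
  constructor
  · rintro ⟨x, rfl⟩
    rw [oldEnc_eq]
    simp only [Nat.unpair_pair]
    refine ⟨x.pos, ?_⟩
    rw [key _ _ x.pos, habs]
    exact x.reduced
  · rintro ⟨h1, h2⟩
    rw [key _ _ h1] at h2
    obtain ⟨z, hz⟩ : ∃ z : ℤ, Encodable.encode z = e.unpair.1 :=
      ⟨Denumerable.ofNat ℤ e.unpair.1, Denumerable.encode_ofNat _⟩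
    rw [← hz, habs] at h2
    refine ⟨⟨z, e.unpair.2, h1.ne', h2⟩, ?_⟩
    rw [oldEnc_eq]
    simp [hz]

theorem primrec_range_oldEnc : PrimrecPred fun e => e ∈ Set.range oldEnc := by
  refine PrimrecPred.of_eq ?_ fun e => (mem_range_oldEnc e).symm
  have hb : Primrec fun e : ℕ => e.unpair.2 := Primrec.snd.comp Primrec.unpair
  have ha : Primrec fun e : ℕ => (e.unpair.1 + 1) / 2 :=
    Primrec.nat_div.comp (Primrec.nat_add.comp (Primrec.fst.comp Primrec.unpair) (Primrec.const 1))
      (Primrec.const 2)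
  refine PrimrecPred.and (PrimrecRel.comp Primrec.nat_lt (Primrec.const 0) hb) ?_
  have hR : PrimrecRel fun (c e : ℕ) =>
      ¬ (((e.unpair.1 + 1) / 2) % c = 0 ∧ e.unpair.2 % c = 0 ∧ c ≠ 1) := by
    refine PrimrecPred.not (PrimrecPred.and ?_ (PrimrecPred.and ?_ (PrimrecPred.not ?_)))
    · exact PrimrecRel.comp Primrec.eq
        (Primrec.nat_mod.comp (ha.comp Primrec.snd) Primrec.fst) (Primrec.const 0)
    · exact PrimrecRel.comp Primrec.eq
        (Primrec.nat_mod.comp (hb.comp Primrec.snd) Primrec.fst) (Primrec.const 0)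
    · exact PrimrecRel.comp Primrec.eq Primrec.fst (Primrec.const 1)
  exact hR.forall_lt.comp (Primrec.succ.comp hb) Primrec.id

/-- The graph `x = a / b` in lowest terms. -/
theorem re_graph : REPred fun q : ℚ × ℕ × ℕ => q.1.num = (q.2.1 : ℤ) ∧ q.1.den = q.2.2 := by
  classical
  have hP := primrec_range_oldEnc
  have hc : Primrec fun e : ℕ => (List.range e).countP (fun e => e ∈ Set.range oldEnc) := by
    have := Primrec.list_length.comp ((Primrec.listFilter hP).comp Primrec.list_range)
    exact this.of_eq fun e => by rw [List.countP_eq_length_filter]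
  have he : Primrec fun q : ℚ × ℕ × ℕ => Nat.pair (2 * q.2.1) q.2.2 :=
    Primrec₂.natPair.comp (Primrec.nat_mul.comp (Primrec.const 2) (Primrec.fst.comp Primrec.snd))
      (Primrec.snd.comp Primrec.snd)
  have hG : PrimrecPred fun q : ℚ × ℕ × ℕ => Nat.pair (2 * q.2.1) q.2.2 ∈ Set.range oldEnc ∧
      @Encodable.encode ℚ (Primcodable.ofDenumerable ℚ).toEncodable q.1 =
        (List.range (Nat.pair (2 * q.2.1) q.2.2)).countP
        (fun e => e ∈ Set.range oldEnc) :=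
    PrimrecPred.and (hP.comp he)
      (PrimrecRel.comp Primrec.eq (Primrec.encode.comp Primrec.fst) (hc.comp he))
  refine hG.computablePred.to_re.of_eq ?_
  rintro ⟨x, a, b⟩
  dsimp only
  constructor
  · rintro ⟨⟨y, hy⟩, h⟩
    rw [← hy, ← newEnc_eq] at h
    have : x = y :=
      @Encodable.encode_injective ℚ (Primcodable.ofDenumerable ℚ).toEncodable _ _ h
    subst this
    rw [oldEnc_eq, Nat.pair_eq_pair, ← natCast_enc] at hy
    exact ⟨Encodable.encode_injective hy.1, hy.2⟩
  · rintro ⟨h1, h2⟩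
    have : oldEnc x = Nat.pair (2 * a) b := by rw [oldEnc_eq, h1, h2, natCast_enc]
    rw [← this]
    exact ⟨⟨x, rfl⟩, newEnc_eq x⟩

def RatLe (x y : ℚ) (p q : ℕ) : Prop :=
  ∃ t : (ℕ × ℕ) × (ℕ × ℕ), ((x.num = (t.1.1 : ℤ) ∧ x.den = t.1.2) ∧
    (y.num = (t.2.1 : ℤ) ∧ y.den = t.2.2)) ∧
    (p * t.1.2 + t.1.1 * q) * t.2.2 ≤ t.2.1 * (q * t.1.2)

theorem ratLe_iff {x y : ℚ} (hx : 0 < x) (hy : 0 < y) {p q : ℕ} (hq : 0 < q) :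
    RatLe x y p q ↔ (p : ℝ) / q + x ≤ y := by
  have hq' : (0 : ℝ) < q := by exact_mod_cast hq
  have key : ∀ a b a' b' : ℕ, (x.num = (a : ℤ) ∧ x.den = b) → (y.num = (a' : ℤ) ∧ y.den = b') →
      ((p * b + a * q) * b' ≤ a' * (q * b) ↔ (p : ℝ) / q + x ≤ y) := by
    intro a b a' b' ⟨h1, h2⟩ ⟨h3, h4⟩
    have hb : (0 : ℝ) < b := by rw [← h2]; exact_mod_cast x.pos
    have hb' : (0 : ℝ) < b' := by rw [← h4]; exact_mod_cast y.pos
    have ex : (x : ℝ) = a / b := by rw [Rat.cast_def, h1, h2]; simp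
    have ey : (y : ℝ) = a' / b' := by rw [Rat.cast_def, h3, h4]; simp
    rw [ex, ey, div_add_div _ _ hq'.ne' hb.ne', div_le_div_iff₀ (by positivity) hb']
    rw [← Nat.cast_le (α := ℝ)]
    push_cast
    rw [mul_comm (a : ℝ) (q : ℝ)]
  constructor
  · rintro ⟨t, ⟨h1, h2⟩, h3⟩
    exact (key _ _ _ _ h1 h2).1 h3
  · intro h
    have h1 : x.num = (x.num.toNat : ℤ) := (Int.toNat_of_nonneg (Rat.num_pos.2 hx).le).symm
    have h2 : y.num = (y.num.toNat : ℤ) := (Int.toNat_of_nonneg (Rat.num_pos.2 hy).le).symm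
    exact ⟨((x.num.toNat, x.den), (y.num.toNat, y.den)), ⟨⟨h1, rfl⟩, ⟨h2, rfl⟩⟩,
      (key _ _ _ _ ⟨h1, rfl⟩ ⟨h2, rfl⟩).2 h⟩

theorem re_ratLe : REPred fun s : (ℚ × ℚ) × (ℕ × ℕ) => RatLe s.1.1 s.1.2 s.2.1 s.2.2 := by
  unfold RatLe
  refine re_exists (re_and (re_and ?_ ?_) ?_)
  · exact re_comp (f := fun u : ((ℚ × ℚ) × (ℕ × ℕ)) × ((ℕ × ℕ) × (ℕ × ℕ)) => (u.1.1.1, u.2.1))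
      re_graph (Primrec.pair (Primrec.fst.comp (Primrec.fst.comp Primrec.fst))
        (Primrec.fst.comp Primrec.snd)).to_comp
  · exact re_comp (f := fun u : ((ℚ × ℚ) × (ℕ × ℕ)) × ((ℕ × ℕ) × (ℕ × ℕ)) => (u.1.1.2, u.2.2))
      re_graph (Primrec.pair (Primrec.snd.comp (Primrec.fst.comp Primrec.fst))
        (Primrec.snd.comp Primrec.snd)).to_comp
  · have p1 : Primrec fun u : ((ℚ × ℚ) × (ℕ × ℕ)) × ((ℕ × ℕ) × (ℕ × ℕ)) => u.1.2.1 :=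
      Primrec.fst.comp (Primrec.snd.comp Primrec.fst)
    have p2 : Primrec fun u : ((ℚ × ℚ) × (ℕ × ℕ)) × ((ℕ × ℕ) × (ℕ × ℕ)) => u.1.2.2 :=
      Primrec.snd.comp (Primrec.snd.comp Primrec.fst)
    have p3 : Primrec fun u : ((ℚ × ℚ) × (ℕ × ℕ)) × ((ℕ × ℕ) × (ℕ × ℕ)) => u.2.1.1 :=
      Primrec.fst.comp (Primrec.fst.comp Primrec.snd)
    have p4 : Primrec fun u : ((ℚ × ℚ) × (ℕ × ℕ)) × ((ℕ × ℕ) × (ℕ × ℕ)) => u.2.1.2 :=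
      Primrec.snd.comp (Primrec.fst.comp Primrec.snd)
    have p5 : Primrec fun u : ((ℚ × ℚ) × (ℕ × ℕ)) × ((ℕ × ℕ) × (ℕ × ℕ)) => u.2.2.1 :=
      Primrec.fst.comp (Primrec.snd.comp Primrec.snd)
    have p6 : Primrec fun u : ((ℚ × ℚ) × (ℕ × ℕ)) × ((ℕ × ℕ) × (ℕ × ℕ)) => u.2.2.2 :=
      Primrec.snd.comp (Primrec.snd.comp Primrec.snd)
    refine PrimrecPred.computablePred (PrimrecRel.comp Primrec.nat_le ?_ ?_) |>.to_re
    · exact Primrec.nat_mul.comp (Primrec.nat_add.comp (Primrec.nat_mul.comp p1 p4)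
        (Primrec.nat_mul.comp p3 p2)) p6
    · exact Primrec.nat_mul.comp p5 (Primrec.nat_mul.comp p2 p4)

/-- r.e.-ness of `d(α k, α k') + r m < r m'`. -/
theorem re_incl {X : Type*} [MetricSpace X] (K : Set ℕ) (α : ℕ → X) (hX : SemiComputable K α)
    (r : ℕ → ℚ) (hrpos : ∀ n, 0 < r n) (hrcomp : Computable r) :
    REPred fun s : (ℕ × ℕ) × ℕ => s.1.1 ∈ K ∧ s.2.unpair.1 ∈ K ∧
      dist (α s.1.1) (α s.2.unpair.1) + (r s.1.2 : ℝ) < (r s.2.unpair.2 : ℝ) := by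
  have hQ : REPred fun q : ℕ × ℕ × ℕ × ℕ => q.1 ∈ K ∧ q.2.1 ∈ K ∧ 0 < q.2.2.1 ∧ 0 < q.2.2.2 ∧
      dist (α q.1) (α q.2.1) < (q.2.2.1 : ℝ) / (q.2.2.2 : ℝ) := hX.2
  have ck : Computable fun u : ((ℕ × ℕ) × ℕ) × (ℕ × ℕ) => u.1.1.1 :=
    (Primrec.fst.comp (Primrec.fst.comp Primrec.fst)).to_comp
  have cm : Computable fun u : ((ℕ × ℕ) × ℕ) × (ℕ × ℕ) => u.1.1.2 :=
    (Primrec.snd.comp (Primrec.fst.comp Primrec.fst)).to_comp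
  have ck' : Computable fun u : ((ℕ × ℕ) × ℕ) × (ℕ × ℕ) => u.1.2.unpair.1 :=
    (Primrec.fst.comp (Primrec.unpair.comp (Primrec.snd.comp Primrec.fst))).to_comp
  have cm' : Computable fun u : ((ℕ × ℕ) × ℕ) × (ℕ × ℕ) => u.1.2.unpair.2 :=
    (Primrec.snd.comp (Primrec.unpair.comp (Primrec.snd.comp Primrec.fst))).to_comp
  have h1 := re_comp hQ (ck.pair (ck'.pair Computable.snd))
  have h2 := re_comp re_ratLe (((hrcomp.comp cm).pair (hrcomp.comp cm')).pair Computable.snd)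
  refine (re_exists (p := fun (s : (ℕ × ℕ) × ℕ) (t : ℕ × ℕ) =>
    (s.1.1 ∈ K ∧ s.2.unpair.1 ∈ K ∧ 0 < t.1 ∧ 0 < t.2 ∧
      dist (α s.1.1) (α s.2.unpair.1) < (t.1 : ℝ) / (t.2 : ℝ)) ∧
    RatLe (r s.1.2) (r s.2.unpair.2) t.1 t.2) (re_and h1 h2)).of_eq ?_
  rintro ⟨⟨k, m⟩, i⟩
  dsimp only
  constructor
  · rintro ⟨⟨p, q⟩, ⟨hk, hk', hp, hq, hd⟩, hr⟩
    rw [ratLe_iff (hrpos _) (hrpos _) hq] at hr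
    dsimp only at hd
    exact ⟨hk, hk', by linarith⟩
  · rintro ⟨hk, hk', hd⟩
    obtain ⟨z, hz1, hz2⟩ := exists_rat_btwn (lt_sub_iff_add_lt.2 hd)
    have hz0 : (0 : ℝ) < z := dist_nonneg.trans_lt hz1
    have hz0' : 0 < z := by exact_mod_cast hz0
    have hn : (z.num.toNat : ℤ) = z.num := Int.toNat_of_nonneg (Rat.num_pos.2 hz0').le
    have hz : ((z.num.toNat : ℕ) : ℝ) / (z.den : ℕ) = z := by
      rw [Rat.cast_def z, ← Int.cast_natCast, hn]
    refine ⟨(z.num.toNat, z.den), ⟨hk, hk', ?_, z.pos, ?_⟩, ?_⟩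
    · have := Rat.num_pos.2 hz0'
      dsimp only
      omega
    · dsimp only
      rw [hz]; exact hz1
    · rw [ratLe_iff (hrpos _) (hrpos _) z.pos]
      dsimp only
      rw [hz]; linarith

theorem exists_small {ι X : Type*} [MetricSpace X] (c : ι → X) (ρ : ι → ℝ) (x : X) (w : List ι)
    (h : ∀ i ∈ w, dist (c i) x < ρ i) : ∃ ε > 0, ∀ i ∈ w, dist (c i) x + ε ≤ ρ i := by
  induction w with
  | nil => exact ⟨1, one_pos, by simp⟩
  | cons a w ih =>
    obtain ⟨ε, h0, hε⟩ := ih fun i hi => h i (List.mem_cons_of_mem _ hi)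
    have ha := h a (by simp)
    refine ⟨min ε (ρ a - dist (c a) x), lt_min h0 (by linarith), ?_⟩
    intro i hi
    have e1 := min_le_left ε (ρ a - dist (c a) x)
    have e2 := min_le_right ε (ρ a - dist (c a) x)
    rcases List.mem_cons.1 hi with rfl | hi
    · linarith
    · linarith [hε i hi]

/-- if (X,d,α) is a semi-computable metric space, L is r.e., and f is
(U,V)-computable (for the bases U_{⟨k,m⟩} = B(α k, r m), V_{⟨l,n⟩} = B(β l, r n)),
then there is an r.e. topological (α,β)-approximation system for f. -/
theorem stmt16 {X Y : Type*} [MetricSpace X] [MetricSpace Y]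
    (K L : Set ℕ) (α : ℕ → X) (β : ℕ → Y)
    (hX : SemiComputable K α) (hβ : Dense (β '' L)) (hLre : IsRE L)
    (r : ℕ → ℚ) (hrpos : ∀ n, 0 < r n)
    (hracc : ∀ ε : ℝ, 0 < ε → ∃ n, (r n : ℝ) < ε) (hrcomp : Computable r)
    (E : Set X) (f : X → Y)
    (hcomp : ∃ F : Set ℕ → Set ℕ, IsEnumOp F ∧
        ∀ x ∈ E, {j | ∃ l ∈ L, ∃ n : ℕ, j = Nat.pair l n ∧ dist (β l) (f x) < (r n : ℝ)}
          = F {i | ∃ k ∈ K, ∃ m : ℕ, i = Nat.pair k m ∧ dist (α k) x < (r m : ℝ)}) :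
    ∃ S : Set (ℕ × ℕ × ℕ × ℕ), IsRE S ∧ (∀ s ∈ S, s.1 ∈ K ∧ s.2.2.1 ∈ L) ∧
      ∀ x ∈ E, ∀ l ∈ L, ∀ n : ℕ,
        dist (β l) (f x) < (r n : ℝ) ↔
          ∃ k m, (k, m, l, n) ∈ S ∧ dist (α k) x < (r m : ℝ) := by
  obtain ⟨F, ⟨W, hW, hF⟩, hfF⟩ := hcomp
  have hI := re_incl K α hX r hrpos hrcomp
  have hWr : REPred fun u : List ℕ × ℕ => u ∈ W := hW
  have hLr : REPred fun u : ℕ => u ∈ L := hLre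
  have hK : REPred fun u : ℕ => u ∈ K := by
    have hQ : REPred fun q : ℕ × ℕ × ℕ × ℕ => q.1 ∈ K ∧ q.2.1 ∈ K ∧ 0 < q.2.2.1 ∧ 0 < q.2.2.2 ∧
      dist (α q.1) (α q.2.1) < (q.2.2.1 : ℝ) / (q.2.2.2 : ℝ) := hX.2
    refine (re_comp (f := fun k : ℕ => (k, k, 1, 1)) hQ (Primrec.pair Primrec.id
      (Primrec.pair Primrec.id (Primrec.const (1, 1)))).to_comp).of_eq ?_
    intro k
    simp
  refine ⟨{s | (s.1 ∈ K ∧ s.2.2.1 ∈ L) ∧ ∃ w : List ℕ, (w, Nat.pair s.2.2.1 s.2.2.2) ∈ W ∧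
    ∀ t ∈ w.map (fun i => ((s.1, s.2.1), i)), t.1.1 ∈ K ∧ t.2.unpair.1 ∈ K ∧
      dist (α t.1.1) (α t.2.unpair.1) + (r t.1.2 : ℝ) < (r t.2.unpair.2 : ℝ)}, ?_,
    fun s hs => hs.1, ?_⟩
  · refine re_and (re_and (re_comp hK Computable.fst) (re_comp hLr
      (Primrec.fst.comp (Primrec.snd.comp Primrec.snd)).to_comp)) (re_exists (re_and ?_ ?_))
    · refine re_comp (f := fun u : (ℕ × ℕ × ℕ × ℕ) × List ℕ =>
        (u.2, Nat.pair u.1.2.2.1 u.1.2.2.2)) hWr (Primrec.to_comp ?_)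
      exact Primrec.pair Primrec.snd (Primrec₂.natPair.comp
        (Primrec.fst.comp (Primrec.snd.comp (Primrec.snd.comp Primrec.fst)))
        (Primrec.snd.comp (Primrec.snd.comp (Primrec.snd.comp Primrec.fst))))
    · refine re_comp (f := fun u : (ℕ × ℕ × ℕ × ℕ) × List ℕ =>
        u.2.map (fun i => ((u.1.1, u.1.2.1), i))) (re_forall_list hI) (Primrec.to_comp ?_)
      refine Primrec.list_map Primrec.snd (Primrec.pair (Primrec.pair ?_ ?_) Primrec.snd)
      · exact Primrec.fst.comp (Primrec.fst.comp Primrec.fst)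
      · exact Primrec.fst.comp (Primrec.snd.comp (Primrec.fst.comp Primrec.fst))
  · intro x hx l hl n
    have hfx := hfF x hx
    rw [hF] at hfx
    have hiff : dist (β l) (f x) < (r n : ℝ) ↔ ∃ w : List ℕ,
        (∀ i ∈ w, i.unpair.1 ∈ K ∧ dist (α i.unpair.1) x < (r i.unpair.2 : ℝ)) ∧
        (w, Nat.pair l n) ∈ W := by
      have h1 := Set.ext_iff.1 hfx (Nat.pair l n)
      simp only [Set.mem_setOf_eq] at h1
      have h2 : ∀ i : ℕ, (∃ k ∈ K, ∃ m : ℕ, i = Nat.pair k m ∧ dist (α k) x < (r m : ℝ)) ↔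
          (i.unpair.1 ∈ K ∧ dist (α i.unpair.1) x < (r i.unpair.2 : ℝ)) := by
        intro i
        constructor
        · rintro ⟨k, hk, m, rfl, h⟩
          simpa using ⟨hk, h⟩
        · rintro ⟨hk, h⟩
          exact ⟨_, hk, _, (Nat.pair_unpair i).symm, h⟩
      simp only [h2] at h1
      rw [← h1]
      constructor
      · intro h
        exact ⟨l, hl, n, rfl, h⟩
      · rintro ⟨l', _, n', he, h⟩
        obtain ⟨rfl, rfl⟩ := Nat.pair_eq_pair.1 he
        exact h
    rw [hiff]
    simp only [Set.mem_setOf_eq, List.forall_mem_map]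
    constructor
    · rintro ⟨w, hw, hwW⟩
      obtain ⟨ε, hε, hs⟩ := exists_small (fun i : ℕ => α i.unpair.1)
        (fun i => (r i.unpair.2 : ℝ)) x w fun i hi => (hw i hi).2
      obtain ⟨m, hm⟩ := hracc (ε / 2) (by linarith)
      have hm0 : (0 : ℝ) < r m := by exact_mod_cast hrpos m
      obtain ⟨_, ⟨k, hk, rfl⟩, hd⟩ := hX.1.exists_dist_lt x hm0
      rw [dist_comm] at hd
      refine ⟨k, m, ⟨⟨hk, hl⟩, w, hwW, fun i hi => ⟨hk, (hw i hi).1, ?_⟩⟩, hd⟩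
      have := hs i hi
      have := dist_triangle_right (α k) (α i.unpair.1) x
      linarith
    · rintro ⟨k, m, ⟨⟨hk, _⟩, w, hwW, hw⟩, hd⟩
      refine ⟨w, fun i hi => ⟨(hw i hi).2.1, ?_⟩, hwW⟩
      have := (hw i hi).2.2
      have := dist_triangle_left (α i.unpair.1) x (α k)
      linarith
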